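/- Suppose |X^L(t)| ≤ M₀ e^{-αt} for all t ≥ 0 for some M₀ ≥ 1 and α > 0. Let U₀ be an open neighborhood of 0 in C([-r,0],ℝⁿ) and h : ℝ × U₀ → ℝⁿ a continuous map such that for every ε > 0 there is δ > 0 with |h(t,φ)| ≤ ε ‖φ‖ whenever (t,φ) ∈ ℝ × U₀ and ‖φ‖ < δ. Then there exist M ≥ 1, β > 0, and ρ > 0 such that for every t₀ ∈ ℝ, every φ ∈ C([-r,0],ℝⁿ) with ‖φ‖ < ρ, and every non-continuable solution x of ẋ(t) = L x_t + h(t, x_t) with x_{t₀} = φ, the solution x is defined on all of [t₀-r, ∞) and satisfies sup_{θ∈[-r,0]} |x(t+θ)| ≤ M e^{-β(t-t₀)} ‖φ‖ for all t ≥ t₀. -/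

import Mathlib

open MeasureTheory

/-- `X` is the principal fundamental matrix solution of `ẋ(t) = L x_t`:
`X = O` on `[-r,0)`, `X` continuous on `[0,∞)`, `X(0) = I`, and for every `ξ` and
`t ≥ 0`, `X(t)ξ = ξ + L(θ ↦ ∫_0^{max(t+θ,0)} X(s)ξ ds)`. -/
def IsPFMS {n : ℕ} (r : ℝ)
    (L : C(Set.Icc (-r) (0:ℝ), Fin n → ℝ) →L[ℝ] (Fin n → ℝ))
    (X : ℝ → ((Fin n → ℝ) →L[ℝ] (Fin n → ℝ))) : Prop :=
  (∀ t ∈ Set.Ico (-r) (0:ℝ), X t = 0) ∧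
  ContinuousOn X (Set.Ici (0:ℝ)) ∧ X 0 = 1 ∧
  ∀ ξ : Fin n → ℝ, ∀ t, 0 ≤ t → ∃ ψ : C(Set.Icc (-r) (0:ℝ), Fin n → ℝ),
    (∀ θ : Set.Icc (-r) (0:ℝ), ψ θ = ∫ s in (0:ℝ)..(max (t + (θ : ℝ)) 0), X s ξ) ∧
    X t ξ = ξ + L ψ

/-- `x` is a solution of the RFDE `ẋ(t) = F(t, x_t)` on `[t₀ - r, b)` (`b ∈ (t₀, ∞]`)
with initial history `x_{t₀} = φ` and history segments staying in `U₀`: `x` is continuous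
on `[t₀ - r, b)` and, for `t₀ ≤ t < b`, the history segment `χ = x_t` lies in `U₀` and
`x` is differentiable at `t` (right derivative at `t₀`) with derivative `F(t, x_t)`. -/
def IsSolOn {n : ℕ} (r : ℝ)
    (U₀ : Set C(Set.Icc (-r) (0:ℝ), Fin n → ℝ))
    (F : ℝ × C(Set.Icc (-r) (0:ℝ), Fin n → ℝ) → (Fin n → ℝ))
    (t₀ : ℝ) (b : EReal)
    (φ : C(Set.Icc (-r) (0:ℝ), Fin n → ℝ)) (x : ℝ → Fin n → ℝ) : Prop :=
  (t₀ : EReal) < b ∧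
  (∀ θ : Set.Icc (-r) (0:ℝ), x (t₀ + θ) = φ θ) ∧
  ContinuousOn x {t : ℝ | t₀ - r ≤ t ∧ (t : EReal) < b} ∧
  ∀ t : ℝ, t₀ ≤ t → (t : EReal) < b →
    ∃ χ : C(Set.Icc (-r) (0:ℝ), Fin n → ℝ),
      (∀ θ : Set.Icc (-r) (0:ℝ), χ θ = x (t + θ)) ∧ χ ∈ U₀ ∧
      HasDerivWithinAt x (F (t, χ)) (Set.Ici t₀) t

/-- A solution on `[t₀ - r, b)` is non-continuable if no solution on a strictly larger
interval `[t₀ - r, b')` restricts to it. -/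
def IsNoncontinuableSol {n : ℕ} (r : ℝ)
    (U₀ : Set C(Set.Icc (-r) (0:ℝ), Fin n → ℝ))
    (F : ℝ × C(Set.Icc (-r) (0:ℝ), Fin n → ℝ) → (Fin n → ℝ))
    (t₀ : ℝ) (b : EReal)
    (φ : C(Set.Icc (-r) (0:ℝ), Fin n → ℝ)) (x : ℝ → Fin n → ℝ) : Prop :=
  IsSolOn r U₀ F t₀ b φ x ∧
  ∀ (b' : EReal) (x' : ℝ → Fin n → ℝ), b < b' → IsSolOn r U₀ F t₀ b' φ x' →
    ¬ ∀ t : ℝ, t₀ - r ≤ t → (t : EReal) < b → x' t = x t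

section

open Set Filter Topology

section Segments

variable {E : Type*} [NormedAddCommGroup E]

/-- The history segment `z_t : θ ↦ z (t + θ)` on `[-r, 0]`. -/
def seg (r : ℝ) (z : C(ℝ, E)) (t : ℝ) : C(Icc (-r) (0 : ℝ), E) :=
  ⟨fun θ => z (t + θ), by fun_prop⟩

@[simp]
theorem seg_apply (r : ℝ) (z : C(ℝ, E)) (t : ℝ) (θ : Icc (-r) (0 : ℝ)) :
    seg r z t θ = z (t + θ) := rfl

theorem continuous_seg (r : ℝ) : Continuous fun p : C(ℝ, E) × ℝ => seg r p.1 p.2 := by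
  refine ContinuousMap.continuous_of_continuous_uncurry _ ?_
  change Continuous fun q : (C(ℝ, E) × ℝ) × Icc (-r) (0 : ℝ) => q.1.1 (q.1.2 + q.2)
  fun_prop

theorem Continuous.seg {Y : Type*} [TopologicalSpace Y] {r : ℝ} {z : Y → C(ℝ, E)} {t : Y → ℝ}
    (hz : Continuous z) (ht : Continuous t) : Continuous fun y => seg r (z y) (t y) :=
  (continuous_seg r).comp (hz.prodMk ht)

theorem seg_congr {r : ℝ} {z z' : C(ℝ, E)} {t : ℝ} (h : ∀ s ≤ t, z s = z' s) :
    seg r z t = seg r z' t := by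
  ext θ
  exact h _ (by linarith [θ.2.2])

theorem norm_seg_le {r : ℝ} {z : C(ℝ, E)} {t c : ℝ} (hc : 0 ≤ c) (h : ∀ s ≤ t, ‖z s‖ ≤ c) :
    ‖seg r z t‖ ≤ c :=
  (ContinuousMap.norm_le _ hc).2 fun θ => h _ (by linarith [θ.2.2])

end Segments

section Peano

variable {E : Type*} [NormedAddCommGroup E] {r : ℝ}

/-- Functions agreeing with `u` before `B`, with modulus of continuity controlled by that of
`u` stopped at `B` and by `K`, form a compact set. -/
theorem isCompact_setOf_modulus [ProperSpace E] (u : C(ℝ, E)) (B K : ℝ) :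
    IsCompact {y : C(ℝ, E) | (∀ t ≤ B, y t = u t) ∧
      ∀ t t', dist (y t) (y t') ≤ dist (u (min t B)) (u (min t' B)) + K * |t - t'|} := by
  have hlim (t : ℝ) : Tendsto (fun t' => dist (u (min t B)) (u (min t' B)) + K * |t - t'|)
      (𝓝 t) (𝓝 0) := by
    have : Continuous fun t' => dist (u (min t B)) (u (min t' B)) + K * |t - t'| := by fun_prop
    simpa using this.tendsto t
  refine ArzelaAscoli.isCompact_of_equicontinuous _ ?_ ?_
  · have himg : ContinuousMap.toFun '' {y : C(ℝ, E) | (∀ t ≤ B, y t = u t) ∧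
        ∀ t t', dist (y t) (y t') ≤ dist (u (min t B)) (u (min t' B)) + K * |t - t'|} =
        {y : ℝ → E | (∀ t ≤ B, y t = u t) ∧
        ∀ t t', dist (y t) (y t') ≤ dist (u (min t B)) (u (min t' B)) + K * |t - t'|} := by
      ext y
      constructor
      · rintro ⟨z, hz, rfl⟩
        exact hz
      · intro hy
        refine ⟨⟨y, continuous_iff_continuousAt.2 fun t => ?_⟩, hy, rfl⟩
        refine tendsto_iff_dist_tendsto_zero.2 (squeeze_zero (fun _ => dist_nonneg) (fun t' => ?_)
          (hlim t))
        rw [dist_comm]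
        exact hy.2 t t'
    rw [himg]
    refine (isCompact_univ_pi fun t => isCompact_closedBall (u B)
      (dist (u (min t B)) (u B) + K * |t - B|)).of_isClosed_subset ?_ ?_
    · simp only [ofPred_and, ofPred_forall]
      refine IsClosed.inter ?_ ?_
      · exact isClosed_iInter fun t => isClosed_iInter fun _ =>
          isClosed_eq (continuous_apply t) continuous_const
      · exact isClosed_iInter fun t => isClosed_iInter fun t' =>
          isClosed_le ((continuous_apply t).dist (continuous_apply t')) continuous_const
    · intro y hy t _
      have := hy.2 t B
      rw [hy.1 B le_rfl, min_self] at this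
      exact this
  · intro t
    rw [Metric.equicontinuousAt_iff_right]
    intro ε hε
    filter_upwards [(hlim t).eventually (gt_mem_nhds hε)] with t' ht' y
    exact (y.2.2 t t').trans_lt ht'

theorem continuous_comp_seg (G : C(ℝ × C(Icc (-r) (0 : ℝ), E), E)) (y : C(ℝ, E)) (d : ℝ) :
    Continuous fun s => G (s, seg r y (s - d)) :=
  G.continuous.comp (continuous_id.prodMk (continuous_const.seg (by fun_prop)))

variable [NormedSpace ℝ E]

/-- Tonelli's operator for `ẏ = G(t, y_t)` with history `u` up to time `B`, with the right-hand
side delayed by `d`. -/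
noncomputable def tonelli (G : C(ℝ × C(Icc (-r) (0 : ℝ), E), E)) (u : C(ℝ, E)) (B d : ℝ)
    (y : C(ℝ, E)) :
    C(ℝ, E) where
  toFun t := u (min t B) + ∫ s in B..max t B, G (s, seg r y (s - d))
  continuous_toFun := by
    have h_int := intervalIntegral.continuous_primitive
      (fun a b => (continuous_comp_seg G y d).intervalIntegrable (μ := volume) a b) B
    have hmax : Continuous fun t => max t B := by fun_prop
    exact Continuous.add (by fun_prop) (h_int.comp hmax)

theorem tonelli_apply (G : C(ℝ × C(Icc (-r) (0 : ℝ), E), E)) (u : C(ℝ, E)) (B d : ℝ)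
    (y : C(ℝ, E)) (t : ℝ) :
    tonelli G u B d y t = u (min t B) + ∫ s in B..max t B, G (s, seg r y (s - d)) := rfl

theorem tonelli_of_le (G : C(ℝ × C(Icc (-r) (0 : ℝ), E), E)) (u : C(ℝ, E)) (B d : ℝ)
    (y : C(ℝ, E)) {t : ℝ} (ht : t ≤ B) : tonelli G u B d y t = u t := by
  simp [tonelli_apply, ht]

theorem tonelli_congr (G : C(ℝ × C(Icc (-r) (0 : ℝ), E), E)) (u : C(ℝ, E)) {B d a : ℝ}
    {y y' : C(ℝ, E)} (h : ∀ t ≤ a, y t = y' t) {t : ℝ} (ht : t ≤ a + d) :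
    tonelli G u B d y t = tonelli G u B d y' t := by
  rcases le_total t B with htB | htB
  · simp [tonelli_of_le, htB]
  · rw [tonelli_apply, tonelli_apply]
    congr 1
    refine intervalIntegral.integral_congr fun s hs => ?_
    rw [max_eq_left htB, uIcc_of_le htB] at hs
    rw [seg_congr fun τ hτ => h τ (by linarith [hs.2])]

/-- The Tonelli iterates stabilise on longer and longer intervals. -/
theorem tonelli_iterate_succ_eq (G : C(ℝ × C(Icc (-r) (0 : ℝ), E), E)) (u : C(ℝ, E)) (B d : ℝ)
    (m : ℕ) {t : ℝ} (ht : t ≤ B + m * d) :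
    (tonelli G u B d)^[m + 1] u t = (tonelli G u B d)^[m] u t := by
  induction m generalizing t with
  | zero => simpa using tonelli_of_le G u B d u (by simpa using ht)
  | succ m ih =>
    rw [Function.iterate_succ_apply']
    conv_rhs => rw [Function.iterate_succ_apply']
    exact tonelli_congr G u (d := d) (a := B + m * d) (t := t) (fun s hs => ih hs)
      (by push_cast at ht; linarith)

theorem dist_tonelli_le (G : C(ℝ × C(Icc (-r) (0 : ℝ), E), E)) (u : C(ℝ, E)) (B d : ℝ)
    {K : ℝ} (hK : ∀ p, ‖G p‖ ≤ K) (y : C(ℝ, E)) (t t' : ℝ) :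
    dist (tonelli G u B d y t) (tonelli G u B d y t') ≤
      dist (u (min t B)) (u (min t' B)) + K * |t - t'| := by
  have hK0 : 0 ≤ K := (norm_nonneg _).trans (hK (0, 0))
  rw [tonelli_apply, tonelli_apply]
  refine (dist_add_add_le _ _ _ _).trans (add_le_add le_rfl ?_)
  have hG := continuous_comp_seg G y d
  rw [dist_eq_norm, intervalIntegral.integral_interval_sub_left (hG.intervalIntegrable _ _)
    (hG.intervalIntegrable _ _)]
  refine (intervalIntegral.norm_integral_le_of_norm_le_const fun s _ => hK _).trans ?_
  exact mul_le_mul_of_nonneg_left (abs_max_sub_max_le_abs t t' B) hK0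

/-- Peano's theorem for functional differential equations with bounded right-hand side. -/
theorem exists_integral_solution [ProperSpace E] (G : C(ℝ × C(Icc (-r) (0 : ℝ), E), E))
    {K : ℝ} (hK : ∀ p, ‖G p‖ ≤ K) (u : C(ℝ, E)) (B : ℝ) :
    ∃ y : C(ℝ, E), (∀ t ≤ B, y t = u t) ∧
      ∀ t ∈ Icc B (B + 1), y t = u B + ∫ s in B..t, G (s, seg r y s) := by
  set d : ℕ → ℝ := fun k => ((k : ℝ) + 1)⁻¹ with hd
  set y : ℕ → C(ℝ, E) := fun k => (tonelli G u B (d k))^[k + 1] u with hy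
  have hmem (k : ℕ) : y k ∈ {y : C(ℝ, E) | (∀ t ≤ B, y t = u t) ∧
      ∀ t t', dist (y t) (y t') ≤ dist (u (min t B)) (u (min t' B)) + K * |t - t'|} := by
    simp only [hy, Function.iterate_succ_apply']
    exact ⟨fun t ht => tonelli_of_le _ _ _ _ _ ht, dist_tonelli_le _ _ _ _ hK _⟩
  have hfix (k : ℕ) {t : ℝ} (ht : t ∈ Icc B (B + 1)) :
      y k t = u B + ∫ s in B..t, G (s, seg r (y k) (s - d k)) := by
    have h1 : ((k + 1 : ℕ) : ℝ) * d k = 1 := by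
      simp only [hd]
      push_cast
      exact mul_inv_cancel₀ (by positivity)
    have := tonelli_iterate_succ_eq G u B (d k) (k + 1) (t := t) (by rw [h1]; exact ht.2)
    rw [Function.iterate_succ_apply', tonelli_apply, min_eq_right ht.1, max_eq_left ht.1] at this
    exact this.symm
  obtain ⟨z, hz, σ, hσ, hlim⟩ := (isCompact_setOf_modulus u B K).tendsto_subseq hmem
  refine ⟨z, hz.1, fun t ht => ?_⟩
  have hd0 : Tendsto (fun k => d (σ k)) atTop (𝓝 0) :=
    tendsto_inv_atTop_zero.comp ((tendsto_atTop_add_const_right _ 1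
      tendsto_natCast_atTop_atTop).comp hσ.tendsto_atTop)
  have heval : Tendsto (fun k => y (σ k) t) atTop (𝓝 (z t)) :=
    ((continuous_eval_const t : Continuous fun f : C(ℝ, E) => f t).tendsto z).comp hlim
  refine tendsto_nhds_unique heval ?_
  simp only [hfix _ ht]
  refine tendsto_const_nhds.add ?_
  refine intervalIntegral.tendsto_integral_filter_of_dominated_convergence (fun _ => K)
    (.of_forall fun k => (continuous_comp_seg G _ _).aestronglyMeasurable)
    (.of_forall fun k => .of_forall fun s _ => hK _) intervalIntegrable_const
    (.of_forall fun s _ => ?_)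
  have hs : Tendsto (fun k => s - d (σ k)) atTop (𝓝 s) := by
    simpa using tendsto_const_nhds.sub hd0
  have hseg := ((continuous_seg r).tendsto (z, s)).comp (hlim.prodMk_nhds hs)
  exact (G.continuous.tendsto _).comp (tendsto_const_nhds.prodMk_nhds hseg)

end Peano

section VariationOfConstants

variable {E : Type*} [NormedAddCommGroup E] [NormedSpace ℝ E]

theorem integral_integral_triangle_swap {K : ℝ → ℝ → E} (hK : Continuous (Function.uncurry K))
    {t : ℝ} (ht : 0 ≤ t) :
    ∫ τ in (0 : ℝ)..t, ∫ s in (0 : ℝ)..τ, K τ s = ∫ s in (0 : ℝ)..t, ∫ τ in s..t, K τ s := by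
  have hswap := intervalIntegral_intervalIntegral_swap (a := 0) (b := t) (c := 0) (d := t)
    (F := fun τ s => {p : ℝ × ℝ | p.2 < p.1}.indicator (Function.uncurry K) (τ, s)) (by
      refine IntegrableOn.indicator ?_ (measurableSet_lt measurable_snd measurable_fst)
      refine (hK.continuousOn.integrableOn_compact
        (isCompact_Icc.prod isCompact_Icc : IsCompact (Icc 0 t ×ˢ Icc 0 t))).mono_set ?_
      rw [uIoc_of_le ht]
      exact prod_mono Ioc_subset_Icc_self Ioc_subset_Icc_self)
  refine Eq.trans ?_ (hswap.trans ?_)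
  · refine intervalIntegral.integral_congr fun τ hτ => ?_
    rw [uIcc_of_le ht] at hτ
    change _ = ∫ s in (0 : ℝ)..t, (Iio τ).indicator (K τ) s
    rw [intervalIntegral.integral_of_le ht, intervalIntegral.integral_of_le hτ.1,
      setIntegral_indicator measurableSet_Iio, integral_Ioc_eq_integral_Ioo]
    congr 2
    ext s
    simp only [mem_Ioo, mem_inter_iff, mem_Ioc, mem_Iio]
    grind
  · refine intervalIntegral.integral_congr fun s hs => ?_
    rw [uIcc_of_le ht] at hs
    change ∫ τ in (0 : ℝ)..t, (Ioi s).indicator (fun τ => K τ s) τ = _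
    rw [intervalIntegral.integral_of_le ht, intervalIntegral.integral_of_le hs.2,
      setIntegral_indicator measurableSet_Ioi, Ioc_inter_Ioi, max_eq_right hs.1]

/-- The primitive of `z` on `[0, ∞)`, extended by zero. -/
noncomputable def primitive (z : C(ℝ, E)) : C(ℝ, E) where
  toFun t := ∫ s in (0 : ℝ)..max t 0, z s
  continuous_toFun :=
    (intervalIntegral.continuous_primitive (fun a b => z.continuous.intervalIntegrable a b) 0).comp
      (continuous_id.max continuous_const)

theorem primitive_apply (z : C(ℝ, E)) (t : ℝ) : primitive z t = ∫ s in (0 : ℝ)..max t 0, z s := rfl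

theorem primitive_of_nonpos (z : C(ℝ, E)) {t : ℝ} (ht : t ≤ 0) : primitive z t = 0 := by
  simp [primitive_apply, ht]

theorem primitive_of_nonneg (z : C(ℝ, E)) {t : ℝ} (ht : 0 ≤ t) :
    primitive z t = ∫ s in (0 : ℝ)..t, z s := by
  simp [primitive_apply, ht]

theorem primitive_sub (z w : C(ℝ, E)) : primitive (z - w) = primitive z - primitive w := by
  ext t
  exact intervalIntegral.integral_sub (z.continuous.intervalIntegrable _ _)
    (w.continuous.intervalIntegrable _ _)

/-- The convolution `t ↦ ∫₀ᵗ X (t - s) (g s) ds` on `[0, ∞)`, extended by zero. -/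
noncomputable def causalConv (X : C(ℝ, E →L[ℝ] E)) (g : C(ℝ, E)) : C(ℝ, E) where
  toFun t := ∫ s in (0 : ℝ)..max t 0, X (t - s) (g s)
  continuous_toFun := by
    refine intervalIntegral.continuous_parametric_intervalIntegral_of_continuous ?_ (by fun_prop)
    change Continuous fun p : ℝ × ℝ => X (p.1 - p.2) (g p.2)
    fun_prop

theorem causalConv_apply (X : C(ℝ, E →L[ℝ] E)) (g : C(ℝ, E)) (t : ℝ) :
    causalConv X g t = ∫ s in (0 : ℝ)..max t 0, X (t - s) (g s) := rfl

theorem primitive_clm_apply [CompleteSpace E] (X : C(ℝ, E →L[ℝ] E)) (t : ℝ) (ξ : E) :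
    primitive X t ξ = ∫ s in (0 : ℝ)..max t 0, X s ξ :=
  ContinuousLinearMap.intervalIntegral_apply (X.continuous.intervalIntegrable _ _) ξ

theorem primitive_causalConv [CompleteSpace E] (X : C(ℝ, E →L[ℝ] E)) (g : C(ℝ, E)) :
    primitive (causalConv X g) = causalConv (primitive X) g := by
  ext t
  rcases le_total t 0 with ht | ht
  · simp [primitive_of_nonpos, causalConv_apply, ht]
  rw [primitive_of_nonneg _ ht, causalConv_apply, max_eq_left ht]
  have hK : Continuous (Function.uncurry fun τ s => X (τ - s) (g s)) := by
    change Continuous fun p : ℝ × ℝ => X (p.1 - p.2) (g p.2)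
    fun_prop
  refine Eq.trans ?_ ((integral_integral_triangle_swap hK ht).trans ?_)
  · refine intervalIntegral.integral_congr fun τ hτ => ?_
    rw [uIcc_of_le ht] at hτ
    simp [causalConv_apply, hτ.1]
  · refine intervalIntegral.integral_congr fun s hs => ?_
    rw [uIcc_of_le ht] at hs
    rw [primitive_clm_apply, max_eq_left (by linarith [hs.2]),
      intervalIntegral.integral_comp_sub_right (fun τ => X τ (g s)), sub_self]

variable {r : ℝ}

/-- Continuous linear maps on the history space commute with integrals. -/
theorem clm_integral_comm [CompleteSpace E] (L : C(Icc (-r) (0 : ℝ), E) →L[ℝ] E)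
    {c : ℝ → C(Icc (-r) (0 : ℝ), E)} (hc : Continuous c) (a b : ℝ) {ψ : C(Icc (-r) (0 : ℝ), E)}
    (hψ : ∀ θ, ψ θ = ∫ s in a..b, c s θ) : ∫ s in a..b, L (c s) = L ψ := by
  rw [L.intervalIntegral_comp_comm (hc.intervalIntegrable a b)]
  congr 1
  ext1 θ
  rw [hψ]
  exact ((ContinuousMap.evalCLM ℝ θ).intervalIntegral_comp_comm
    (hc.intervalIntegrable (μ := volume) a b)).symm

/-- The convolution with the fundamental solution solves the forced equation in integral form. -/
theorem causalConv_eq [CompleteSpace E] (L : C(Icc (-r) (0 : ℝ), E) →L[ℝ] E)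
    {X : C(ℝ, E →L[ℝ] E)}
    (hX : ∀ ξ t, 0 ≤ t → ∀ ψ : C(Icc (-r) (0 : ℝ), E), (∀ θ, ψ θ = primitive X (t + θ) ξ) →
      X t ξ = ξ + L ψ) (g : C(ℝ, E)) {t : ℝ} (ht : 0 ≤ t) :
    causalConv X g t = primitive g t + L (seg r (primitive (causalConv X g)) t) := by
  set c : ℝ → C(Icc (-r) (0 : ℝ), E) := fun s =>
    ⟨fun θ => primitive X (t - s + θ) (g s), by fun_prop⟩ with hc
  have hcc : Continuous c := by
    refine ContinuousMap.continuous_of_continuous_uncurry _ ?_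
    change Continuous fun q : ℝ × Icc (-r) (0 : ℝ) => primitive X (t - q.1 + q.2) (g q.1)
    fun_prop
  have hL : ∫ s in (0 : ℝ)..t, L (c s) = L (seg r (primitive (causalConv X g)) t) := by
    refine clm_integral_comm L hcc 0 t fun θ => ?_
    rw [primitive_causalConv, seg_apply, causalConv_apply]
    have h_int (a b : ℝ) : IntervalIntegrable (fun s => primitive X (t + θ - s) (g s)) volume a b :=
      Continuous.intervalIntegrable (by fun_prop) a b
    have hz : ∫ s in (max (t + θ) 0)..t, primitive X (t + θ - s) (g s) = 0 := by
      refine (intervalIntegral.integral_congr (g := fun _ => (0 : E)) fun s hs => ?_).trans (by simp)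
      have hθ := θ.2.2
      rw [uIcc_of_le (max_le (by linarith) ht)] at hs
      have := (le_max_left _ _).trans hs.1
      simp [primitive_of_nonpos X (t := t + θ - s) (by linarith)]
    rw [← add_zero (∫ s in (0 : ℝ)..max (t + θ) 0, _), ← hz,
      intervalIntegral.integral_add_adjacent_intervals (h_int _ _) (h_int _ _)]
    refine intervalIntegral.integral_congr fun s _ => ?_
    simp only [hc, ContinuousMap.coe_mk]
    congr 2
    ring
  rw [← hL, primitive_of_nonneg g ht, causalConv_apply, max_eq_left ht,
    ← intervalIntegral.integral_add (g.continuous.intervalIntegrable _ _)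
      (Continuous.intervalIntegrable (u := fun s => L (c s)) (by fun_prop) _ _)]
  refine intervalIntegral.integral_congr fun s hs => ?_
  rw [uIcc_of_le ht] at hs
  exact hX (g s) (t - s) (by linarith [hs.2]) (c s) fun θ => rfl

theorem eq_primitive_add_of_hasDerivAt [CompleteSpace E] (L : C(Icc (-r) (0 : ℝ), E) →L[ℝ] E)
    {z g : C(ℝ, E)} {T : ℝ} (hz0 : ∀ t ≤ 0, z t = 0)
    (hz : ∀ t ∈ Ioo 0 T, HasDerivAt z (L (seg r z t) + g t) t) {t : ℝ} (ht : t ∈ Icc 0 T) :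
    z t = primitive g t + L (seg r (primitive z) t) := by
  have hseg : Continuous fun s => seg r z s := continuous_const.seg continuous_id
  have hLseg : Continuous fun s => L (seg r z s) := L.continuous.comp hseg
  have hftc := intervalIntegral.integral_eq_sub_of_hasDerivAt_of_le ht.1 z.continuous.continuousOn
    (fun s hs => hz s ⟨hs.1, hs.2.trans_le ht.2⟩)
    ((hLseg.add g.continuous).intervalIntegrable _ _)
  rw [intervalIntegral.integral_add (hLseg.intervalIntegrable _ _)
    (g.continuous.intervalIntegrable _ _), hz0 0 le_rfl, sub_zero] at hftc
  rw [primitive_of_nonneg g ht.1, ← hftc, add_comm]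
  congr 1
  refine clm_integral_comm L hseg 0 t fun θ => ?_
  have hvanish {a b : ℝ} (ha : a ≤ 0) (hb : b ≤ 0) : ∫ s in a..b, z s = 0 := by
    exact (intervalIntegral.integral_congr (g := fun _ => (0 : E))
      fun s hs => hz0 s (hs.2.trans (max_le ha hb))).trans (by simp)
  simp only [seg_apply]
  rw [intervalIntegral.integral_comp_add_right z, zero_add,
    ← intervalIntegral.integral_add_adjacent_intervals (b := 0)
      (z.continuous.intervalIntegrable _ _) (z.continuous.intervalIntegrable _ _),
    hvanish θ.2.2 le_rfl, zero_add]
  rcases le_total (t + θ) 0 with h | h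
  · rw [primitive_of_nonpos _ h, hvanish le_rfl h]
  · rw [primitive_of_nonneg _ h]

theorem eq_zero_of_eq_clm_seg_primitive [CompleteSpace E] (L : C(Icc (-r) (0 : ℝ), E) →L[ℝ] E)
    {D : C(ℝ, E)} {T : ℝ} (hD : ∀ t ∈ Icc 0 T, D t = L (seg r (primitive D) t)) {t : ℝ}
    (ht : t ∈ Icc 0 T) : D t = 0 := by
  set m : ℝ → ℝ := fun t => ∫ s in (0 : ℝ)..t, ‖D s‖ with hm
  have hDn : Continuous fun s => ‖D s‖ := by fun_prop
  have hm0 {s : ℝ} (hs : 0 ≤ s) : 0 ≤ m s :=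
    intervalIntegral.integral_nonneg hs fun _ _ => norm_nonneg _
  have hmono {a b : ℝ} (hab : a ≤ b) : m a ≤ m b := by
    have := intervalIntegral.integral_nonneg (μ := volume) (f := fun s => ‖D s‖) hab
      fun _ _ => norm_nonneg _
    rw [← intervalIntegral.integral_interval_sub_left (hDn.intervalIntegrable 0 b)
      (hDn.intervalIntegrable 0 a)] at this
    exact sub_nonneg.1 this
  have hbound {s : ℝ} (hs : s ∈ Icc 0 T) : ‖D s‖ ≤ ‖L‖ * m s := by
    rw [hD s hs]
    refine (L.le_opNorm _).trans (mul_le_mul_of_nonneg_left ?_ (norm_nonneg _))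
    refine norm_seg_le (hm0 hs.1) fun τ hτ => ?_
    rcases le_total τ 0 with h | h
    · rw [primitive_of_nonpos _ h, norm_zero]
      exact hm0 hs.1
    · rw [primitive_of_nonneg _ h]
      exact (intervalIntegral.norm_integral_le_integral_norm h).trans (hmono hτ)
  have hder (s : ℝ) : HasDerivAt m ‖D s‖ s := hDn.integral_hasStrictDerivAt 0 s |>.hasDerivAt
  have hmz := eq_zero_of_abs_deriv_le_mul_abs_self_of_eq_zero_right (f := m) (K := ‖L‖) (a := 0)
    (b := T) (fun s _ => (hder s).continuousAt.continuousWithinAt)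
    (fun s _ => (hder s).hasDerivWithinAt) (by simp [hm]) (fun s hs => by
      rw [norm_norm, Real.norm_of_nonneg (hm0 hs.1)]
      exact hbound (Ico_subset_Icc_self hs)) t ht
  have := hbound ht
  rw [hmz, mul_zero] at this
  exact norm_le_zero_iff.1 this

/-- The variation of constants formula for zero initial history. -/
theorem eq_causalConv_of_hasDerivAt [CompleteSpace E] (L : C(Icc (-r) (0 : ℝ), E) →L[ℝ] E)
    {X : C(ℝ, E →L[ℝ] E)}
    (hX : ∀ ξ t, 0 ≤ t → ∀ ψ : C(Icc (-r) (0 : ℝ), E), (∀ θ, ψ θ = primitive X (t + θ) ξ) →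
      X t ξ = ξ + L ψ)
    {z g : C(ℝ, E)} {T : ℝ} (hz0 : ∀ t ≤ 0, z t = 0)
    (hz : ∀ t ∈ Ioo 0 T, HasDerivAt z (L (seg r z t) + g t) t) {t : ℝ} (ht : t ∈ Icc 0 T) :
    z t = causalConv X g t := by
  refine sub_eq_zero.1 (eq_zero_of_eq_clm_seg_primitive L (D := z - causalConv X g)
    (fun s hs => ?_) ht)
  have hsub : seg r (primitive (z - causalConv X g)) s =
      seg r (primitive z) s - seg r (primitive (causalConv X g)) s := by
    rw [primitive_sub]
    rfl
  rw [hsub, map_sub, ContinuousMap.sub_apply, eq_primitive_add_of_hasDerivAt L hz0 hz hs,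
    causalConv_eq L hX g hs.1]
  abel

theorem norm_causalConv_le {X : C(ℝ, E →L[ℝ] E)} {g : C(ℝ, E)} {M₀ α β A t : ℝ} (hβ : β < α)
    (hM₀ : 0 ≤ M₀) (hA : 0 ≤ A) (ht : 0 ≤ t)
    (hX : ∀ t, 0 ≤ t → ‖X t‖ ≤ M₀ * Real.exp (-α * t))
    (hg : ∀ s ∈ Icc 0 t, ‖g s‖ ≤ A * Real.exp (-β * s)) :
    ‖causalConv X g t‖ ≤ M₀ * A / (α - β) * Real.exp (-β * t) := by
  have hαβ : 0 < α - β := sub_pos.2 hβ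
  have h_int : ∫ s in (0 : ℝ)..t, Real.exp ((α - β) * s) =
      (α - β)⁻¹ * (Real.exp ((α - β) * t) - 1) := by
    rw [intervalIntegral.integral_comp_mul_left _ hαβ.ne', integral_exp]
    simp
  calc ‖causalConv X g t‖
      ≤ ∫ s in (0 : ℝ)..t, M₀ * A * Real.exp (-α * t) * Real.exp ((α - β) * s) := by
        rw [causalConv_apply, max_eq_left ht]
        refine intervalIntegral.norm_integral_le_of_norm_le ht (.of_forall fun s hs => ?_)
          (Continuous.intervalIntegrable (by fun_prop) _ _)
        calc ‖X (t - s) (g s)‖ ≤ ‖X (t - s)‖ * ‖g s‖ := (X (t - s)).le_opNorm _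
          _ ≤ (M₀ * Real.exp (-α * (t - s))) * (A * Real.exp (-β * s)) := by
            gcongr
            · exact hX _ (by linarith [hs.2])
            · exact hg s (Ioc_subset_Icc_self hs)
          _ = M₀ * A * Real.exp (-α * t) * Real.exp ((α - β) * s) := by
            rw [mul_mul_mul_comm, ← Real.exp_add, mul_assoc (M₀ * A), ← Real.exp_add]
            ring_nf
    _ = M₀ * A / (α - β) * (Real.exp (-α * t) * Real.exp ((α - β) * t) - Real.exp (-α * t)) := by
        rw [intervalIntegral.integral_const_mul, h_int]
        ring
    _ ≤ M₀ * A / (α - β) * Real.exp (-β * t) := by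
        have hexp : Real.exp (-α * t) * Real.exp ((α - β) * t) = Real.exp (-β * t) := by
          rw [← Real.exp_add]
          ring_nf
        rw [hexp]
        refine mul_le_mul_of_nonneg_left ?_ (by positivity)
        linarith [Real.exp_pos (-α * t)]

end VariationOfConstants

section Estimate

variable {E : Type*} [NormedAddCommGroup E] [NormedSpace ℝ E] [CompleteSpace E] {r : ℝ}

/-- Exponential decay of solutions of a linear equation under a small forcing term. -/
theorem norm_le_of_small_forcing (hr : 0 < r) (L : C(Icc (-r) (0 : ℝ), E) →L[ℝ] E)
    {X : C(ℝ, E →L[ℝ] E)}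
    (hX : ∀ ξ t, 0 ≤ t → ∀ ψ : C(Icc (-r) (0 : ℝ), E), (∀ θ, ψ θ = primitive X (t + θ) ξ) →
      X t ξ = ξ + L ψ)
    {M₀ α : ℝ} (hM₀ : 1 ≤ M₀) (hα : 0 < α)
    (hdecay : ∀ t, 0 ≤ t → ‖X t‖ ≤ M₀ * Real.exp (-α * t))
    {φ : C(Icc (-r) (0 : ℝ), E)} {x f : C(ℝ, E)} {T : ℝ} (hT : 0 ≤ T)
    (hinit : ∀ t ≤ 0, x t = φ (projIcc (-r) 0 (neg_nonpos.2 hr.le) t))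
    (hder : ∀ t ∈ Ioo 0 T, HasDerivAt x (L (seg r x t) + f t) t)
    (hf : ∀ t ∈ Icc 0 T,
      ‖f t‖ ≤ α / (4 * M₀ * Real.exp (α / 2 * r)) * ‖seg r x t‖)
    {t : ℝ} (ht : t ∈ Icc (-r) T) :
    ‖x t‖ ≤ 2 * (1 + 2 * M₀ * (‖L‖ * Real.exp (α * r) + α) / α) *
      Real.exp (-(α / 2) * t) * ‖φ‖ := by
  have hr0 : -r ≤ 0 := neg_nonpos.2 hr.le
  set ε := α / (4 * M₀ * Real.exp (α / 2 * r)) with hε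
  set C₁ := ‖L‖ * Real.exp (α * r) + α with hC₁
  set φ₀ : E := φ (projIcc (-r) 0 hr0 0) with hφ₀
  have hε0 : 0 ≤ ε := by positivity
  have hC₁0 : 0 ≤ C₁ := by positivity
  have hφn (s : ℝ) : ‖φ (projIcc (-r) 0 hr0 s)‖ ≤ ‖φ‖ := φ.norm_coe_le_norm _
  set p : C(ℝ, E) := ⟨fun s => Real.exp (-α * max s 0) • φ (projIcc (-r) 0 hr0 s), by
    have : Continuous (projIcc (-r) 0 hr0) := continuous_projIcc
    fun_prop⟩ with hp
  have hpn (s : ℝ) : ‖p s‖ ≤ Real.exp (-α * max s 0) * ‖φ‖ := by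
    simp only [hp, ContinuousMap.coe_mk, norm_smul, Real.norm_eq_abs, Real.abs_exp]
    gcongr
    exact hφn s
  have hpseg {s : ℝ} : ‖seg r p s‖ ≤ Real.exp (α * r) * Real.exp (-α * s) * ‖φ‖ := by
    refine (ContinuousMap.norm_le _ (by positivity)).2 fun θ => (hpn _).trans ?_
    rw [← Real.exp_add]
    gcongr
    have h1 := le_max_left (s + (θ : ℝ)) 0
    have h2 := θ.2.1
    nlinarith
  have hpder {s : ℝ} (hs : 0 < s) : HasDerivAt p (-(α * Real.exp (-α * s)) • φ₀) s := by
    have h1 : HasDerivAt (fun s : ℝ => Real.exp (-α * s)) (-(α * Real.exp (-α * s))) s := by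
      have := ((hasDerivAt_id s).const_mul (-α)).exp
      simpa [mul_comm] using this
    refine (h1.smul_const φ₀).congr_of_eventuallyEq ?_
    filter_upwards [lt_mem_nhds hs] with τ hτ
    simp only [hp, ContinuousMap.coe_mk, hφ₀]
    rw [max_eq_left hτ.le, projIcc_of_right_le hr0 hτ.le, projIcc_right]
  set g : C(ℝ, E) :=
    ⟨fun s => L (seg r p s) + (α * Real.exp (-α * s)) • φ₀ + f s, by
      have : Continuous fun s => seg r p s := continuous_const.seg continuous_id
      fun_prop⟩ with hg
  have hz0 : ∀ s ≤ 0, (x - p) s = 0 := fun s hs => by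
    simp [hp, hinit s hs, hs]
  have hzder : ∀ s ∈ Ioo 0 T, HasDerivAt (x - p : C(ℝ, E)) (L (seg r (x - p) s) + g s) s := by
    intro s hs
    have hseg : seg r (x - p) s = seg r x s - seg r p s := rfl
    rw [ContinuousMap.coe_sub]
    refine ((hder s hs).sub (hpder hs.1)).congr_deriv ?_
    rw [hseg, map_sub]
    simp only [hg, ContinuousMap.coe_mk, neg_smul]
    abel
  -- the weighted supremum of the solution
  obtain ⟨t₁, ht₁, hmax⟩ := isCompact_Icc.exists_isMaxOn (nonempty_Icc.2 (hr0.trans hT))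
    (f := fun s => Real.exp (α / 2 * s) * ‖x s‖) (by fun_prop : ContinuousOn _ (Icc (-r) T))
  set S := Real.exp (α / 2 * t₁) * ‖x t₁‖ with hS
  have hS0 : 0 ≤ S := by positivity
  have hxS {s : ℝ} (hs : s ∈ Icc (-r) T) : ‖x s‖ ≤ Real.exp (-(α / 2) * s) * S := by
    have h1 : Real.exp (α / 2 * s) * ‖x s‖ ≤ S := hmax hs
    calc ‖x s‖ = Real.exp (-(α / 2) * s) * (Real.exp (α / 2 * s) * ‖x s‖) := by
          rw [← mul_assoc, ← Real.exp_add]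
          simp
      _ ≤ _ := by gcongr
  have hxseg {s : ℝ} (hs : s ∈ Icc 0 T) :
      ‖seg r x s‖ ≤ Real.exp (α / 2 * r) * S * Real.exp (-(α / 2) * s) := by
    refine (ContinuousMap.norm_le _ (by positivity)).2 fun θ => ?_
    have hθ := θ.2
    refine (hxS ⟨by linarith [hθ.1, hs.1], by linarith [hθ.2, hs.2]⟩).trans ?_
    rw [mul_right_comm, ← Real.exp_add]
    gcongr
    nlinarith [hθ.1]
  have hgb : ∀ s ∈ Icc 0 T,
      ‖g s‖ ≤ (C₁ * ‖φ‖ + ε * Real.exp (α / 2 * r) * S) * Real.exp (-(α / 2) * s) := by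
    intro s hs
    have hexp : Real.exp (-α * s) ≤ Real.exp (-(α / 2) * s) :=
      Real.exp_le_exp.2 (by nlinarith [hs.1])
    calc ‖g s‖ ≤ ‖L (seg r p s)‖ + ‖(α * Real.exp (-α * s)) • φ₀‖ + ‖f s‖ := norm_add₃_le
      _ ≤ ‖L‖ * (Real.exp (α * r) * Real.exp (-α * s) * ‖φ‖) + α * Real.exp (-α * s) * ‖φ‖ +
          ε * (Real.exp (α / 2 * r) * S * Real.exp (-(α / 2) * s)) := by
        refine add_le_add (add_le_add ?_ ?_) ?_
        · exact (L.le_opNorm _).trans (by gcongr; exact hpseg)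
        · rw [norm_smul, Real.norm_of_nonneg (by positivity)]
          gcongr
          exact hφn 0
        · exact (hf s hs).trans (by gcongr; exact hxseg hs)
      _ = C₁ * ‖φ‖ * Real.exp (-α * s) +
          ε * Real.exp (α / 2 * r) * S * Real.exp (-(α / 2) * s) := by rw [hC₁]; ring
      _ ≤ C₁ * ‖φ‖ * Real.exp (-(α / 2) * s) +
          ε * Real.exp (α / 2 * r) * S * Real.exp (-(α / 2) * s) := by gcongr
      _ = _ := by ring
  have hεM : M₀ * (ε * Real.exp (α / 2 * r) * S) / (α - α / 2) = S / 2 := by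
    rw [hε]
    field_simp
    ring
  have hSle : S ≤ (1 + 2 * M₀ * C₁ / α) * ‖φ‖ + S / 2 := by
    rcases le_total t₁ 0 with h | h
    · have h1 : S ≤ 1 * ‖φ‖ := by
        rw [hS, hinit t₁ h]
        gcongr
        · exact Real.exp_le_one_iff.2 (by nlinarith)
        · exact hφn t₁
      have h2 : 0 ≤ 2 * M₀ * C₁ / α * ‖φ‖ := by positivity
      linarith
    · have hz := norm_causalConv_le (X := X) (g := g) (M₀ := M₀) (α := α) (β := α / 2)
        (A := C₁ * ‖φ‖ + ε * Real.exp (α / 2 * r) * S) (t := t₁) (by linarith) (by linarith)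
        (by positivity) h hdecay fun s hs => hgb s ⟨hs.1, hs.2.trans ht₁.2⟩
      rw [← eq_causalConv_of_hasDerivAt L hX hz0 hzder ⟨h, ht₁.2⟩, mul_add, add_div, hεM] at hz
      have hpt : ‖p t₁‖ ≤ Real.exp (-(α / 2) * t₁) * ‖φ‖ := by
        refine (hpn t₁).trans ?_
        rw [max_eq_left h]
        gcongr
        linarith
      have hx : ‖x t₁‖ ≤ ‖p t₁‖ + ‖(x - p) t₁‖ := by
        refine le_trans (le_of_eq ?_) (norm_add_le _ _)
        simp
      have hx' : ‖x t₁‖ ≤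
          ((1 + 2 * M₀ * C₁ / α) * ‖φ‖ + S / 2) * Real.exp (-(α / 2) * t₁) := by
        refine (hx.trans (add_le_add hpt hz)).trans (le_of_eq ?_)
        field_simp
        ring
      calc S ≤ Real.exp (α / 2 * t₁) *
            (((1 + 2 * M₀ * C₁ / α) * ‖φ‖ + S / 2) * Real.exp (-(α / 2) * t₁)) := by
            rw [hS]
            gcongr
        _ = ((1 + 2 * M₀ * C₁ / α) * ‖φ‖ + S / 2) *
            (Real.exp (α / 2 * t₁) * Real.exp (-(α / 2) * t₁)) := by ring
        _ = _ := by
            rw [← Real.exp_add]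
            simp
  refine (hxS ht).trans ?_
  calc Real.exp (-(α / 2) * t) * S
      ≤ Real.exp (-(α / 2) * t) * (2 * ((1 + 2 * M₀ * C₁ / α) * ‖φ‖)) := by
        gcongr
        linarith
    _ = _ := by ring

end Estimate

section Solutions

variable {n : ℕ} {r : ℝ} {U₀ : Set C(Icc (-r) (0 : ℝ), Fin n → ℝ)}

/-- The continuous extension to `ℝ` of the restriction of the fundamental solution to `[0, ∞)`. -/
theorem IsPFMS.exists_continuousMap {L : C(Icc (-r) (0 : ℝ), Fin n → ℝ) →L[ℝ] (Fin n → ℝ)}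
    {X : ℝ → ((Fin n → ℝ) →L[ℝ] (Fin n → ℝ))} (hX : IsPFMS r L X) :
    ∃ Y : C(ℝ, (Fin n → ℝ) →L[ℝ] (Fin n → ℝ)), (∀ t, 0 ≤ t → Y t = X t) ∧
      ∀ ξ t, 0 ≤ t → ∀ ψ : C(Icc (-r) (0 : ℝ), Fin n → ℝ),
        (∀ θ, ψ θ = primitive Y (t + θ) ξ) → Y t ξ = ξ + L ψ := by
  obtain ⟨-, hcont, -, heq⟩ := hX
  have hY : Continuous fun t => X (max t 0) :=
    hcont.comp_continuous (by fun_prop) fun t => le_max_right t 0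
  refine ⟨⟨fun t => X (max t 0), hY⟩, fun t ht => by simp [ht], fun ξ t ht ψ hψ => ?_⟩
  obtain ⟨χ, hχ, hXχ⟩ := heq ξ t ht
  have : ψ = χ := by
    ext1 θ
    rw [hψ, hχ, primitive_clm_apply]
    refine intervalIntegral.integral_congr fun s hs => ?_
    rw [uIcc_of_le (le_max_right _ _)] at hs
    simp [hs.1]
  simpa [this, ht] using hXχ

/-- Shift a solution to initial time `0` and extend its restriction to `[-r, T]` to `ℝ`. -/
theorem IsSolOn.exists_continuousMap (hr : 0 < r)
    {F : ℝ × C(Icc (-r) (0 : ℝ), Fin n → ℝ) → (Fin n → ℝ)} {t₀ : ℝ} {b : EReal}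
    {φ : C(Icc (-r) (0 : ℝ), Fin n → ℝ)} {x : ℝ → Fin n → ℝ} (hsol : IsSolOn r U₀ F t₀ b φ x)
    {T : ℝ} (hT : 0 ≤ T) (hTb : ((t₀ + T : ℝ) : EReal) < b) :
    ∃ y : C(ℝ, Fin n → ℝ),
      (∀ t ≤ 0, y t = φ (projIcc (-r) 0 (neg_nonpos.2 hr.le) t)) ∧
      (∀ t ∈ Icc (-r) T, y t = x (t₀ + t)) ∧ (∀ t ∈ Icc 0 T, seg r y t ∈ U₀) ∧
      ∀ t ∈ Ioo 0 T, HasDerivAt y (F (t₀ + t, seg r y t)) t := by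
  obtain ⟨-, hφ, hcont, hder⟩ := hsol
  have hlt {s : ℝ} (hs : s ≤ T) : ((t₀ + s : ℝ) : EReal) < b :=
    lt_of_le_of_lt (EReal.coe_le_coe_iff.2 (by linarith)) hTb
  have hy : Continuous fun t => x (t₀ + max (-r) (min t T)) := by
    refine hcont.comp_continuous (by fun_prop) fun t => ⟨?_, hlt (max_le ?_ (min_le_right _ _))⟩
    · linarith [le_max_left (-r) (min t T)]
    · linarith
  set y : C(ℝ, Fin n → ℝ) := ⟨_, hy⟩ with hydef
  have hyx : ∀ t ∈ Icc (-r) T, y t = x (t₀ + t) := fun t ht => by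
    simp only [hydef, ContinuousMap.coe_mk]
    rw [min_eq_left ht.2, max_eq_right ht.1]
  have hχ {t : ℝ} (ht : t ∈ Icc 0 T) {χ : C(Icc (-r) (0 : ℝ), Fin n → ℝ)}
      (h : ∀ θ : Icc (-r) (0 : ℝ), χ θ = x (t₀ + t + θ)) : χ = seg r y t := by
    ext1 θ
    have hθ := θ.2
    rw [h, seg_apply, hyx _ ⟨by linarith [hθ.1, ht.1], by linarith [hθ.2, ht.2]⟩, add_assoc]
  refine ⟨y, fun t ht => ?_, hyx, fun t ht => ?_, fun t ht => ?_⟩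
  · rw [← hφ, coe_projIcc]
    simp only [hydef, ContinuousMap.coe_mk]
    rw [min_eq_left (ht.trans hT), min_eq_right ht]
  · obtain ⟨χ, h, hU, -⟩ := hder (t₀ + t) (by linarith [ht.1]) (hlt ht.2)
    rwa [← hχ ht h]
  · obtain ⟨χ, h, -, hd⟩ := hder (t₀ + t) (by linarith [ht.1]) (hlt ht.2.le)
    rw [← hχ (Ioo_subset_Icc_self ht) h]
    have hd' : HasDerivAt x (F (t₀ + t, χ)) (t₀ + t) :=
      hd.hasDerivAt (Ici_mem_nhds (by linarith [ht.1]))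
    refine (hd'.comp_const_add t₀ t).congr_of_eventuallyEq ?_
    filter_upwards [Ioo_mem_nhds ht.1 ht.2] with s hs
    exact hyx s ⟨by linarith [hs.1], hs.2.le⟩

/-- A priori exponential estimate for solutions with small initial data. -/
theorem exists_exponential_estimate (hr : 0 < r)
    (L : C(Icc (-r) (0 : ℝ), Fin n → ℝ) →L[ℝ] (Fin n → ℝ))
    {X : ℝ → ((Fin n → ℝ) →L[ℝ] (Fin n → ℝ))} (hX : IsPFMS r L X)
    {M₀ α : ℝ} (hM₀ : 1 ≤ M₀) (hα : 0 < α)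
    (hdecay : ∀ t, 0 ≤ t → ‖X t‖ ≤ M₀ * Real.exp (-α * t))
    {h : ℝ × C(Icc (-r) (0 : ℝ), Fin n → ℝ) → (Fin n → ℝ)}
    (hcont : ContinuousOn h (univ ×ˢ U₀)) :
    ∃ M : ℝ, 1 ≤ M ∧ ∃ β > (0 : ℝ), ∃ ε > (0 : ℝ), ∀ δ : ℝ,
      (∀ t, ∀ ψ ∈ U₀, ‖ψ‖ ≤ δ → ‖h (t, ψ)‖ ≤ ε * ‖ψ‖) →
      ∀ (t₀ : ℝ) (φ : C(Icc (-r) (0 : ℝ), Fin n → ℝ)), M * ‖φ‖ < δ →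
      ∀ (b : EReal) (x : ℝ → Fin n → ℝ), IsSolOn r U₀ (fun p => L p.2 + h p) t₀ b φ x →
      ∀ t, t₀ ≤ t → (t : EReal) < b → ∀ θ ∈ Icc (-r) (0 : ℝ),
        ‖x (t + θ)‖ ≤ M * Real.exp (-β * (t - t₀)) * ‖φ‖ := by
  obtain ⟨Y, hYX, hY⟩ := hX.exists_continuousMap
  set C := 1 + 2 * M₀ * (‖L‖ * Real.exp (α * r) + α) / α with hC
  have hC1 : 1 ≤ C := le_add_of_nonneg_right (by positivity)
  have hexp1 : 1 ≤ Real.exp (α / 2 * r) := Real.one_le_exp (by positivity)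
  have hM1 : 1 ≤ 2 * C * Real.exp (α / 2 * r) := by nlinarith
  refine ⟨2 * C * Real.exp (α / 2 * r), hM1, α / 2, by positivity,
    α / (4 * M₀ * Real.exp (α / 2 * r)), by positivity, ?_⟩
  intro δ hδ t₀ φ hφδ b x hsol t ht htb θ hθ
  have hφδ' : ‖φ‖ ≤ δ := by nlinarith [norm_nonneg φ]
  have hδ0 : 0 ≤ δ := (norm_nonneg φ).trans hφδ'
  set T := t - t₀ with hTdef
  have hT : 0 ≤ T := sub_nonneg.2 ht
  obtain ⟨y, hinit, hyx, hyU, hyder⟩ := hsol.exists_continuousMap hr hT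
    (by simpa [hTdef] using htb)
  set κ : ℝ → ℝ := fun s => max 0 (min s T) with hκ
  have hκmem (s : ℝ) : κ s ∈ Icc 0 T := ⟨le_max_left _ _, max_le hT (min_le_right _ _)⟩
  have hκeq {s : ℝ} (hs : s ∈ Icc 0 T) : κ s = s := by simp [hκ, hs.1, hs.2]
  have hκc : Continuous κ := by fun_prop
  set f : C(ℝ, Fin n → ℝ) := ⟨fun s => h (t₀ + κ s, seg r y (κ s)),
    hcont.comp_continuous ((continuous_const.add hκc).prodMk (continuous_const.seg hκc))
      fun s => ⟨mem_univ _, hyU _ (hκmem s)⟩⟩ with hf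
  have hbound {T₁ : ℝ} (hT₁ : T₁ ∈ Icc 0 T) (hy : ∀ s ≤ T₁, ‖y s‖ ≤ δ) {s : ℝ}
      (hs : s ∈ Icc (-r) T₁) : ‖y s‖ ≤ 2 * C * Real.exp (-(α / 2) * s) * ‖φ‖ := by
    refine norm_le_of_small_forcing hr L hY hM₀ hα (fun τ hτ => (hYX τ hτ).symm ▸ hdecay τ hτ)
      (f := f) hT₁.1 hinit (fun τ hτ => ?_) (fun τ hτ => ?_) hs
    · have hτ' : τ ∈ Ioo 0 T := ⟨hτ.1, hτ.2.trans_le hT₁.2⟩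
      simpa only [hf, ContinuousMap.coe_mk, hκeq (Ioo_subset_Icc_self hτ')] using hyder τ hτ'
    · have hτ' : τ ∈ Icc 0 T := ⟨hτ.1, hτ.2.trans hT₁.2⟩
      simp only [hf, ContinuousMap.coe_mk, hκeq hτ']
      exact hδ _ _ (hyU τ hτ') (norm_seg_le hδ0 fun σ hσ => hy σ (hσ.trans hτ.2))
  have hinit' : ∀ s ≤ 0, ‖y s‖ ≤ δ := fun s hs => by
    rw [hinit s hs]
    exact (φ.norm_coe_le_norm _).trans hφδ'
  have hsmall : ∀ s ∈ Icc 0 T, ‖y s‖ < δ := by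
    by_contra! hne
    obtain ⟨T₁, hT₁, hleast⟩ := (isCompact_Icc.inter_right
      (isClosed_le continuous_const (by fun_prop : Continuous fun s => ‖y s‖)) :
        IsCompact (Icc 0 T ∩ {s | δ ≤ ‖y s‖})).exists_isLeast hne
    have hlt : ∀ s < T₁, ‖y s‖ ≤ δ := fun s hs => by
      rcases le_total s 0 with h0 | h0
      · exact hinit' s h0
      · by_contra! hgt
        exact hs.not_ge (hleast ⟨⟨h0, hs.le.trans hT₁.1.2⟩, hgt.le⟩)
    have hle : ∀ s ≤ T₁, ‖y s‖ ≤ δ := by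
      have hcl : closure (Iio T₁) ⊆ {s | ‖y s‖ ≤ δ} :=
        closure_minimal hlt (isClosed_le (by fun_prop) continuous_const)
      rw [closure_Iio] at hcl
      exact fun s hs => hcl hs
    have hyT := hbound hT₁.1 hle (s := T₁) ⟨by linarith [hT₁.1.1], le_rfl⟩
    have : 2 * C * Real.exp (-(α / 2) * T₁) * ‖φ‖ ≤ 2 * C * Real.exp (α / 2 * r) * ‖φ‖ := by
      have hexp : Real.exp (-(α / 2) * T₁) ≤ Real.exp (α / 2 * r) :=
        Real.exp_le_exp.2 (by nlinarith [hT₁.1.1])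
      gcongr
    exact absurd hT₁.2 (not_le.2 ((hyT.trans this).trans_lt hφδ))
  have hθT : T + θ ∈ Icc (-r) T := ⟨by linarith [hθ.1], by linarith [hθ.2]⟩
  have hfin := hbound ⟨hT, le_rfl⟩ (fun s hs => (le_total s 0).elim (hinit' s)
    fun h0 => (hsmall s ⟨h0, hs⟩).le) hθT
  rw [hyx _ hθT, show t₀ + (T + θ) = t + θ by rw [hTdef]; ring] at hfin
  refine hfin.trans ?_
  have hexp : Real.exp (-(α / 2) * (T + θ)) ≤ Real.exp (α / 2 * r + -(α / 2) * T) :=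
    Real.exp_le_exp.2 (by nlinarith [hθ.1])
  rw [mul_assoc (2 * C) (Real.exp (α / 2 * r)), ← Real.exp_add]
  gcongr

end Solutions

section Continuation

/-- The radial retraction onto a closed ball. -/
theorem exists_continuousMap_retraction {V : Type*} [NormedAddCommGroup V] [NormedSpace ℝ V]
    {δ : ℝ} (hδ : 0 < δ) :
    ∃ P : C(V, V), (∀ v, ‖P v‖ ≤ δ) ∧ ∀ v, ‖v‖ ≤ δ → P v = v := by
  have hpos (v : V) : 0 < max δ ‖v‖ := hδ.trans_le (le_max_left _ _)
  refine ⟨⟨fun v => (δ / max δ ‖v‖) • v, ?_⟩, fun v => ?_, fun v hv => ?_⟩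
  · exact (continuous_const.div (by fun_prop) fun v => (hpos v).ne').smul continuous_id
  · rw [ContinuousMap.coe_mk, norm_smul, Real.norm_of_nonneg (div_pos hδ (hpos v)).le,
      div_mul_eq_mul_div, div_le_iff₀ (hpos v)]
    exact mul_le_mul_of_nonneg_left (le_max_right _ _) hδ.le
  · simp [max_eq_left hv, hδ.ne']

theorem hasDerivWithinAt_of_eq_integral {E : Type*} [NormedAddCommGroup E] [NormedSpace ℝ E]
    [CompleteSpace E] {y g : ℝ → E} (hg : Continuous g) {a b : ℝ}
    (h : ∀ t ∈ Icc a b, y t = y a + ∫ s in a..t, g s) {t : ℝ} (ht : t ∈ Ico a b) :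
    HasDerivWithinAt y (g t) (Ici a) t := by
  have hd : HasDerivAt (fun t => y a + ∫ s in a..t, g s) (g t) t :=
    (hg.integral_hasStrictDerivAt a t).hasDerivAt.const_add _
  refine hd.hasDerivWithinAt.congr_of_eventuallyEq ?_ (h t (Ico_subset_Icc_self ht))
  filter_upwards [self_mem_nhdsWithin, mem_nhdsWithin_of_mem_nhds (Iio_mem_nhds ht.2)] with s hs hs'
  exact h s ⟨hs, le_of_lt hs'⟩

variable {n : ℕ} {r : ℝ} {U₀ : Set C(Icc (-r) (0 : ℝ), Fin n → ℝ)}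

/-- A solution with bounded derivative extends continuously past the end of its interval. -/
theorem IsSolOn.exists_continuousMap_extend (hr : 0 < r)
    {F : ℝ × C(Icc (-r) (0 : ℝ), Fin n → ℝ) → (Fin n → ℝ)} {t₀ B : ℝ}
    {φ : C(Icc (-r) (0 : ℝ), Fin n → ℝ)} {x : ℝ → Fin n → ℝ}
    (hsol : IsSolOn r U₀ F t₀ (B : EReal) φ x) {K : ℝ}
    (hK : ∀ t ∈ Ico t₀ B, ∀ χ ∈ U₀, (∀ θ : Icc (-r) (0 : ℝ), χ θ = x (t + θ)) →
      ‖F (t, χ)‖ ≤ K) :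
    ∃ u : C(ℝ, Fin n → ℝ),
      (∀ t ≤ t₀, u t = φ (projIcc (-r) 0 (neg_nonpos.2 hr.le) (t - t₀))) ∧
      ∀ t ∈ Ico (t₀ - r) B, u t = x t := by
  obtain ⟨hlt, hφ, -, hder⟩ := hsol
  have hlt : t₀ < B := EReal.coe_lt_coe_iff.1 hlt
  have hlip : LipschitzOnWith K.toNNReal x (Ico t₀ B) := by
    choose! χ hχ hU hd using fun t (ht : t ∈ Ico t₀ B) =>
      hder t ht.1 (EReal.coe_lt_coe_iff.2 ht.2)
    refine (convex_Ico t₀ B).lipschitzOnWith_of_nnnorm_hasDerivWithin_le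
      (fun t ht => (hd t ht).mono Ico_subset_Ici_self) fun t ht => ?_
    exact NNReal.le_toNNReal_of_coe_le (hK t ht _ (hU t ht) (hχ t ht))
  obtain ⟨v, hv, hxv⟩ := hlip.extend_pi
  have hx₀ : x t₀ = φ (projIcc (-r) 0 (neg_nonpos.2 hr.le) 0) := by
    rw [← hφ]; simp
  have hu : Continuous fun t => if t ≤ t₀ then
      φ (projIcc (-r) 0 (neg_nonpos.2 hr.le) (t - t₀)) else v t := by
    refine Continuous.if_le ?_ hv.continuous continuous_id continuous_const fun t ht => ?_
    · exact φ.continuous.comp (continuous_projIcc.comp (by fun_prop))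
    · obtain rfl : t = t₀ := ht
      rw [sub_self, ← hx₀, hxv ⟨le_rfl, hlt⟩]
  refine ⟨⟨_, hu⟩, fun t ht => if_pos ht, fun t ht => ?_⟩
  rcases le_or_gt t t₀ with h | h
  · have hmem : t - t₀ ∈ Icc (-r) 0 := ⟨by linarith [ht.1], by linarith⟩
    have := hφ ⟨t - t₀, hmem⟩
    rw [ContinuousMap.coe_mk, if_pos h, projIcc_of_mem _ hmem, ← this, add_sub_cancel]
  · rw [ContinuousMap.coe_mk, if_neg h.not_ge, hxv ⟨h.le, ht.2⟩]

/-- A solution on a bounded interval that stays well inside a ball on which the right-hand side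
is bounded is continuable. -/
theorem IsSolOn.exists_continuation (hr : 0 < r)
    {F : ℝ × C(Icc (-r) (0 : ℝ), Fin n → ℝ) → (Fin n → ℝ)}
    (hF : ContinuousOn F (univ ×ˢ U₀)) {δ δ' K : ℝ} (hδ' : 0 ≤ δ') (hδ : δ' < δ)
    (hU : ∀ ψ, ‖ψ‖ ≤ δ → ψ ∈ U₀) (hK : ∀ t ψ, ‖ψ‖ ≤ δ → ‖F (t, ψ)‖ ≤ K)
    {t₀ B : ℝ} {φ : C(Icc (-r) (0 : ℝ), Fin n → ℝ)} {x : ℝ → Fin n → ℝ}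
    (hsol : IsSolOn r U₀ F t₀ (B : EReal) φ x)
    (hx : ∀ t ∈ Ico (t₀ - r) B, ‖x t‖ ≤ δ') :
    ∃ b' : EReal, (B : EReal) < b' ∧ ∃ x' : ℝ → Fin n → ℝ, IsSolOn r U₀ F t₀ b' φ x' ∧
      ∀ t : ℝ, t₀ - r ≤ t → (t : EReal) < B → x' t = x t := by
  have hδ0 : 0 < δ := hδ'.trans_lt hδ
  obtain ⟨P, hPle, hPeq⟩ :=
    exists_continuousMap_retraction (V := C(Icc (-r) (0 : ℝ), Fin n → ℝ)) hδ0
  obtain ⟨hlt, hφ, -, hder⟩ := id hsol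
  have hlt : t₀ < B := EReal.coe_lt_coe_iff.1 hlt
  set G : C(ℝ × C(Icc (-r) (0 : ℝ), Fin n → ℝ), Fin n → ℝ) := ⟨fun p => F (p.1, P p.2),
    hF.comp_continuous (by fun_prop) fun p => ⟨mem_univ _, hU _ (hPle _)⟩⟩ with hG
  have hGF (t : ℝ) {ψ : C(Icc (-r) (0 : ℝ), Fin n → ℝ)} (hψ : ‖ψ‖ ≤ δ) :
      G (t, ψ) = F (t, ψ) := by
    simp [hG, hPeq ψ hψ]
  obtain ⟨u, huφ, hux⟩ := hsol.exists_continuousMap_extend hr (K := K) fun t ht χ _ hχ => by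
    refine hK t χ ((ContinuousMap.norm_le _ hδ0.le).2 fun θ => ?_)
    rw [hχ]
    exact (hx _ ⟨by linarith [ht.1, θ.2.1], by linarith [ht.2, θ.2.2]⟩).trans hδ.le
  obtain ⟨y, hyu, hy⟩ := exists_integral_solution G (fun p => hK _ _ (hPle p.2)) u B
  have hyx : ∀ t ∈ Ico (t₀ - r) B, y t = x t := fun t ht => (hyu t ht.2.le).trans (hux t ht)
  have hy_norm : ∀ t ≤ B, ‖y t‖ ≤ δ' := by
    have hcl : closure (Iio B) ⊆ {s | ‖y s‖ ≤ δ'} := by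
      refine closure_minimal (fun t ht => ?_) (isClosed_le (by fun_prop) continuous_const)
      change ‖y t‖ ≤ δ'
      rcases le_or_gt (t₀ - r) t with h | h
      · exact (hyx t ⟨h, ht⟩).symm ▸ hx t ⟨h, ht⟩
      · have hmem := (projIcc (-r) 0 (neg_nonpos.2 hr.le) (t - t₀)).2
        rw [hyu t (le_of_lt ht), huφ t (by linarith), ← hφ]
        exact hx _ ⟨by linarith [hmem.1], by linarith [hmem.2]⟩
    rw [closure_Iio] at hcl
    exact fun t ht => hcl ht
  have hseg_norm : ∀ t ≤ B, ‖seg r y t‖ ≤ δ' := fun t ht =>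
    norm_seg_le hδ' fun s hs => hy_norm s (hs.trans ht)
  have hgc : Continuous fun s => G (s, seg r y s) :=
    G.continuous.comp (continuous_id.prodMk (continuous_const.seg continuous_id))
  have h_int : ∀ t ∈ Icc t₀ (B + 1), y t = y t₀ + ∫ s in t₀..t, G (s, seg r y s) := by
    have hle : ∀ t ∈ Icc t₀ B, y t = y t₀ + ∫ s in t₀..t, G (s, seg r y s) := fun t ht => by
      rw [intervalIntegral.integral_eq_sub_of_hasDerivAt_of_le ht.1 y.continuous.continuousOn
        (fun s hs => ?_) (hgc.intervalIntegrable _ _), add_sub_cancel]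
      have hsB : s < B := hs.2.trans_le ht.2
      obtain ⟨χ, hχ, -, hd⟩ := hder s hs.1.le (EReal.coe_lt_coe_iff.2 hsB)
      have hχ' : χ = seg r y s := by
        ext1 θ
        rw [hχ, seg_apply, hyx _ ⟨by linarith [hs.1, θ.2.1], by linarith [θ.2.2]⟩]
      rw [hGF s ((hseg_norm s hsB.le).trans hδ.le), ← hχ']
      refine (hd.hasDerivAt (Ici_mem_nhds hs.1)).congr_of_eventuallyEq ?_
      filter_upwards [Ioo_mem_nhds hs.1 hsB] with τ hτ
      exact hyx τ ⟨by linarith [hτ.1], hτ.2⟩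
    intro t ht
    rcases le_total t B with h | h
    · exact hle t ⟨ht.1, h⟩
    · rw [hy t ⟨h, ht.2⟩, ← hyu B le_rfl, hle B ⟨hlt.le, le_rfl⟩, add_assoc,
        intervalIntegral.integral_add_adjacent_intervals (hgc.intervalIntegrable _ _)
          (hgc.intervalIntegrable _ _)]
  obtain ⟨η, hη, hηδ⟩ : ∃ η > 0, ∀ t, |t - B| < η → ‖seg r y t‖ < δ := by
    have hc : Continuous fun t => ‖seg r y t‖ :=
      (continuous_const.seg continuous_id).norm
    exact Metric.eventually_nhds_iff.1
      (hc.continuousAt.eventually_lt_const ((hseg_norm B le_rfl).trans_lt hδ))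
  refine ⟨((B + min η 1 : ℝ) : EReal),
    EReal.coe_lt_coe_iff.2 (lt_add_of_pos_right _ (lt_min hη one_pos)), y,
    ⟨EReal.coe_lt_coe_iff.2 (by linarith [lt_min hη one_pos]), fun θ => ?_,
      y.continuous.continuousOn, fun t ht htb => ⟨seg r y t, fun θ => rfl, ?_⟩⟩,
    fun t ht htb => hyx t ⟨ht, EReal.coe_lt_coe_iff.1 htb⟩⟩
  · rw [hyx _ ⟨by linarith [θ.2.1], by linarith [θ.2.2]⟩, hφ]
  · have htb : t < B + min η 1 := EReal.coe_lt_coe_iff.1 htb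
    have hle : ‖seg r y t‖ ≤ δ := by
      rcases le_or_gt t B with h | h
      · exact (hseg_norm t h).trans hδ.le
      · refine (hηδ t ?_).le
        rw [abs_of_pos (sub_pos.2 h)]
        linarith [min_le_left η 1]
    refine ⟨hU _ hle, ?_⟩
    rw [← hGF t hle]
    exact hasDerivWithinAt_of_eq_integral hgc h_int ⟨ht, by linarith [min_le_right η 1]⟩

end Continuation

end

/-- Principle of linearized stability (stability part) for RFDEs. -/
theorem stmt_16 {n : ℕ} (hn : 0 < n) {r : ℝ} (hr : 0 < r)
    (L : C(Set.Icc (-r) (0:ℝ), Fin n → ℝ) →L[ℝ] (Fin n → ℝ))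
    (X : ℝ → ((Fin n → ℝ) →L[ℝ] (Fin n → ℝ))) (hX : IsPFMS r L X)
    {M₀ α : ℝ} (hM₀ : 1 ≤ M₀) (hα : 0 < α)
    (hdecay : ∀ t, 0 ≤ t → ‖X t‖ ≤ M₀ * Real.exp (-α * t))
    (U₀ : Set C(Set.Icc (-r) (0:ℝ), Fin n → ℝ))
    (hU₀open : IsOpen U₀) (hU₀mem : 0 ∈ U₀)
    (h : ℝ × C(Set.Icc (-r) (0:ℝ), Fin n → ℝ) → (Fin n → ℝ))
    (hcont : ContinuousOn h (Set.univ ×ˢ U₀))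
    (hsmall : ∀ ε > (0:ℝ), ∃ δ > (0:ℝ),
      ∀ (t : ℝ) (φ : C(Set.Icc (-r) (0:ℝ), Fin n → ℝ)),
        φ ∈ U₀ → ‖φ‖ < δ → ‖h (t, φ)‖ ≤ ε * ‖φ‖) :
    ∃ M : ℝ, 1 ≤ M ∧ ∃ β > (0:ℝ), ∃ ρ > (0:ℝ),
      ∀ (t₀ : ℝ) (φ : C(Set.Icc (-r) (0:ℝ), Fin n → ℝ)), ‖φ‖ < ρ →
        ∀ (b : EReal) (x : ℝ → Fin n → ℝ),
          IsNoncontinuableSol r U₀ (fun p => L p.2 + h p) t₀ b φ x →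
          b = ⊤ ∧ ∀ t, t₀ ≤ t → ∀ θ ∈ Set.Icc (-r) (0:ℝ),
            ‖x (t + θ)‖ ≤ M * Real.exp (-β * (t - t₀)) * ‖φ‖ := by
  obtain ⟨M, hM, β, hβ, ε, hε, hest⟩ :=
    exists_exponential_estimate hr L hX hM₀ hα hdecay hcont
  obtain ⟨δ₁, hδ₁, hh⟩ := hsmall ε hε
  obtain ⟨δ₂, hδ₂, hball⟩ := Metric.isOpen_iff.1 hU₀open 0 hU₀mem
  obtain ⟨δ, hδ, hδ₁', hδ₂'⟩ : ∃ δ > 0, δ < δ₁ ∧ δ < δ₂ :=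
    (exists_between (lt_min hδ₁ hδ₂)).imp fun δ h => ⟨h.1, lt_min_iff.1 h.2⟩
  have hMpos : 0 < M := zero_lt_one.trans_le hM
  have hU : ∀ ψ : C(Set.Icc (-r) (0:ℝ), Fin n → ℝ), ‖ψ‖ ≤ δ → ψ ∈ U₀ := fun ψ hψ =>
    hball (mem_ball_zero_iff.2 (hψ.trans_lt hδ₂'))
  have hhδ : ∀ t, ∀ ψ ∈ U₀, ‖ψ‖ ≤ δ → ‖h (t, ψ)‖ ≤ ε * ‖ψ‖ := fun t ψ hψ hle =>
    hh t ψ hψ (hle.trans_lt hδ₁')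
  refine ⟨M, hM, β, hβ, δ / M, by positivity, fun t₀ φ hφ b x hx => ?_⟩
  have hφδ : M * ‖φ‖ < δ := by rwa [lt_div_iff₀' hMpos] at hφ
  have hbound := hest δ hhδ t₀ φ hφδ b x hx.1
  obtain rfl : b = ⊤ := by
    induction b with
    | bot => exact absurd hx.1.1 not_lt_bot
    | top => rfl
    | coe B =>
      have hlt : t₀ < B := EReal.coe_lt_coe_iff.1 hx.1.1
      obtain ⟨b', hb', x', hx', hxx'⟩ := hx.1.exists_continuation hr
        (K := ‖L‖ * δ + ε * δ) (by fun_prop) (by positivity) hφδ hU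
        (fun t ψ hψ => (norm_add_le _ _).trans <| add_le_add
          (L.le_opNorm_of_le hψ)
          ((hhδ t ψ (hU ψ hψ) hψ).trans (mul_le_mul_of_nonneg_left hψ hε.le)))
        fun t ht => by
          have hθ : min (t - t₀) 0 ∈ Set.Icc (-r) (0:ℝ) :=
            ⟨le_min (by linarith [ht.1]) (by linarith), min_le_right _ _⟩
          have hmax : max t t₀ + min (t - t₀) 0 = t := by
            rcases le_total t t₀ with h | h <;> simp [h]
          have := hbound (max t t₀) (le_max_right _ _)
            (EReal.coe_lt_coe_iff.2 (max_lt ht.2 hlt)) _ hθ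
          rw [hmax] at this
          refine this.trans (mul_le_mul_of_nonneg_right ?_ (norm_nonneg φ))
          refine mul_le_of_le_one_right hMpos.le (Real.exp_le_one_iff.2 ?_)
          nlinarith [le_max_right t t₀]
      exact absurd hxx' (hx.2 b' x' hb' hx')
  exact ⟨rfl, fun t ht => hbound t ht (EReal.coe_lt_top t)⟩
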